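/- arXiv:2410.22460 — 5 statements merged into one kernel-verified Lean document; each statement's English description precedes it below -/
import Mathlib

section
/- Non-conflicting transactions commute: if transactions A and B do not conflict (W(A) ∩ W(B) = ∅, R(A) ∩ W(B) = ∅, and W(A) ∩ R(B) = ∅), then for every state σ, apply A (apply B σ) = apply B (apply A σ). -/
/-- A transaction: a finite read set, a finite write set, and an output map
assigning to each state a value for each written address, depending only on the
values of the read addresses. -/
structure OTxn (α V : Type*) where
  reads : Finset α
  writes : Finset α
  out : (α → V) → α → V
  coh : ∀ σ σ' : α → V, (∀ a ∈ reads, σ a = σ' a) → ∀ a ∈ writes, out σ a = out σ' a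

/-- Applying a transaction to a state: the result equals `out σ a` on written
addresses and `σ a` elsewhere. -/
def applyT {α V : Type*} [DecidableEq α] (T : OTxn α V) (σ : α → V) : α → V :=
  fun a => if a ∈ T.writes then T.out σ a else σ a

/-- Transactions `A` and `B` conflict if some data item is written by both,
or read by one and written by the other. -/
def Conflict {α V : Type*} (A B : OTxn α V) : Prop :=
  (∃ a, a ∈ A.writes ∧ a ∈ B.writes) ∨
    (∃ a, a ∈ A.reads ∧ a ∈ B.writes) ∨
    (∃ a, a ∈ A.writes ∧ a ∈ B.reads)

theorem applyT_of_mem {α V : Type*} [DecidableEq α] (T : OTxn α V) (σ : α → V) {a : α}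
    (ha : a ∈ T.writes) : applyT T σ a = T.out σ a :=
  if_pos ha

theorem applyT_of_notMem {α V : Type*} [DecidableEq α] (T : OTxn α V) (σ : α → V) {a : α}
    (ha : a ∉ T.writes) : applyT T σ a = σ a :=
  if_neg ha

/-- A transaction's output is unaffected by first applying a transaction that writes nothing
it reads. -/
theorem OTxn.out_applyT {α V : Type*} [DecidableEq α] (A B : OTxn α V)
    (h : Disjoint A.reads B.writes) (σ : α → V) {a : α} (ha : a ∈ A.writes) :
    A.out (applyT B σ) a = A.out σ a :=
  A.coh _ _ (fun _ hb => applyT_of_notMem B σ (Finset.disjoint_left.mp h hb)) a ha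

/-- Non-conflicting transactions commute. -/
theorem apply_comm_of_not_conflict {α V : Type*} [DecidableEq α] (A B : OTxn α V)
    (hww : A.writes ∩ B.writes = ∅) (hrw : A.reads ∩ B.writes = ∅)
    (hwr : A.writes ∩ B.reads = ∅) :
    ∀ σ : α → V, applyT A (applyT B σ) = applyT B (applyT A σ) := by
  rw [← Finset.disjoint_iff_inter_eq_empty] at hww hrw hwr
  intro σ
  ext a
  by_cases hA : a ∈ A.writes
  · have hB : a ∉ B.writes := Finset.disjoint_left.mp hww hA
    rw [applyT_of_mem A _ hA, applyT_of_notMem B _ hB, applyT_of_mem A _ hA,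
      A.out_applyT B hrw σ hA]
  · by_cases hB : a ∈ B.writes
    · rw [applyT_of_notMem A _ hA, applyT_of_mem B _ hB, applyT_of_mem B _ hB,
        B.out_applyT A hwr.symm σ hB]
    · rw [applyT_of_notMem A _ hA, applyT_of_notMem B _ hB, applyT_of_notMem B _ hB,
        applyT_of_notMem A _ hA]
end

section
/- Any execution order that preserves the relative order of conflicting transactions produces the same final state as serial execution: let T_0, …, T_{n−1} be transactions and π a permutation of {0, …, n−1} such that whenever i < j and T_i conflicts with T_j, the position of i under π precedes that of j. Then for every initial state σ, applying the transactions in the order T_{π(0)}, …, T_{π(n−1)} yields the same final state as applying T_0, …, T_{n−1} in index order. -/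
/-- A step that commutes with every step of a list can be moved past the list. -/
theorem foldl_step_comm {ι S : Type*} (f : S → ι → S) (a : ι) (l : List ι)
    (h : ∀ x ∈ l, ∀ s, f (f s x) a = f (f s a) x) (s : S) :
    f (l.foldl f s) a = l.foldl f (f s a) := by
  induction l generalizing s with
  | nil => rfl
  | cons x l ih =>
    simp only [List.foldl_cons]
    rw [ih (fun y hy => h y (List.mem_cons_of_mem x hy)), h x List.mem_cons_self]

/-- If `m` is sorted by an asymmetric relation and `l` is a rearrangement of `m` in which
every pair of steps out of order commutes, then folding over `l` and `m` agree. -/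
theorem foldl_eq_of_perm_of_pairwise {ι S : Type*} (f : S → ι → S) (r : ι → ι → Prop)
    (hr : ∀ a b, r a b → ¬ r b a) {l m : List ι} (hlm : l.Perm m) (hm : m.Pairwise r)
    (hl : l.Pairwise fun a b => (∀ s, f (f s a) b = f (f s b) a) ∨ r a b) (s : S) :
    l.foldl f s = m.foldl f s := by
  induction m generalizing l s with
  | nil => rw [hlm.eq_nil]
  | cons a m ih =>
    obtain ⟨l₁, l₂, rfl⟩ := List.append_of_mem (hlm.mem_iff.2 List.mem_cons_self)
    have hperm : (l₁ ++ l₂).Perm m := (List.perm_middle.symm.trans hlm).cons_inv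
    rw [List.pairwise_cons] at hm
    have hcomm : ∀ x ∈ l₁, ∀ s, f (f s x) a = f (f s a) x := fun x hx =>
      ((List.pairwise_append.1 hl).2.2 x hx a List.mem_cons_self).resolve_right
        (hr a x (hm.1 x (hperm.mem_iff.1 (List.mem_append_left l₂ hx))))
    have hsub : (l₁ ++ l₂).Sublist (l₁ ++ a :: l₂) :=
      (List.sublist_cons_self a l₂).append_left l₁
    rw [List.foldl_append, List.foldl_cons, foldl_step_comm f a l₁ hcomm, ← List.foldl_append,
      List.foldl_cons, ih hperm hm.2 (hl.sublist hsub)]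

theorem Conflict.symm {α V : Type*} {A B : OTxn α V} (h : Conflict A B) : Conflict B A := by
  unfold Conflict at *
  grind

/-- Transactions that do not conflict commute. -/
theorem applyT_comm_of_not_conflict {α V : Type*} [DecidableEq α] {A B : OTxn α V}
    (h : ¬ Conflict A B) (σ : α → V) : applyT B (applyT A σ) = applyT A (applyT B σ) := by
  simp only [Conflict, not_or, not_exists, not_and] at h
  obtain ⟨hww, hrw, hwr⟩ := h
  have hA : ∀ a ∈ A.writes, A.out (applyT B σ) a = A.out σ a :=
    A.coh _ _ fun a ha => if_neg (hrw a ha)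
  have hB : ∀ a ∈ B.writes, B.out (applyT A σ) a = B.out σ a :=
    B.coh _ _ fun a ha => if_neg fun h' => hwr a h' ha
  funext a
  by_cases ha : a ∈ A.writes
  · simpa [applyT, ha, hww a ha] using (hA a ha).symm
  · by_cases hb : a ∈ B.writes
    · simpa [applyT, ha, hb] using hB a hb
    · simp [applyT, ha, hb]

/-- Any execution order preserving the relative order of conflicting transactions
(the position `π⁻¹ i` of `i` precedes the position `π⁻¹ j` of `j` whenever `i < j`
conflict) produces the same final state as serial execution in index order. -/
theorem conflict_order_preserving_execution_eq {α V : Type*} [DecidableEq α] {n : ℕ}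
    (T : Fin n → OTxn α V) (π : Equiv.Perm (Fin n))
    (hπ : ∀ i j : Fin n, i < j → Conflict (T i) (T j) → π.symm i < π.symm j) :
    ∀ σ : α → V,
      (List.finRange n).foldl (fun s k => applyT (T (π k)) s) σ =
        (List.finRange n).foldl (fun s k => applyT (T k) s) σ := by
  intro σ
  rw [← List.foldl_map (f := π) (g := fun s k => applyT (T k) s)]
  refine foldl_eq_of_perm_of_pairwise _ (· < ·) (fun _ _ => lt_asymm)
    (Equiv.Perm.map_finRange_perm π) (List.pairwise_lt_finRange n) ?_ σ
  rw [List.pairwise_map]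
  refine (List.pairwise_lt_finRange n).imp fun {i j} hij => ?_
  rcases lt_or_ge (π i) (π j) with hlt | hge
  · exact Or.inr hlt
  · refine Or.inl (applyT_comm_of_not_conflict fun hc => ?_)
    have hne : π j ≠ π i := fun h => hij.ne' (π.injective h)
    have hji := hπ (π j) (π i) (lt_of_le_of_ne hge hne) hc.symm
    simp only [Equiv.symm_apply_apply] at hji
    exact lt_asymm hij hji
end

section
/- For a finite list of pairwise non-conflicting transactions, any permutation of the execution order produces the same final state: if T_0, …, T_{m−1} are pairwise non-conflicting, then for every permutation π of {0, …, m−1} and every state σ, applying T_{π(0)}, …, T_{π(m−1)} in order yields the same final state as applying T_0, …, T_{m−1} in order. -/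
/-- The output of `B` on its written addresses is unaffected by running first a
transaction that writes none of the addresses read by `B`. -/
theorem OTxn.out_applyT_of_disjoint {α V : Type*} [DecidableEq α] {A B : OTxn α V}
    (hAB : ∀ a ∈ B.reads, a ∉ A.writes) (σ : α → V) {a : α} (ha : a ∈ B.writes) :
    B.out (applyT A σ) a = B.out σ a :=
  B.coh _ _ (fun b hb => if_neg (hAB b hb)) a ha

/-- For pairwise non-conflicting transactions, any permutation of the execution
order produces the same final state. -/
theorem perm_execution_eq_of_pairwise_nonconflicting {α V : Type*} [DecidableEq α]
    {m : ℕ} (T : Fin m → OTxn α V)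
    (h : ∀ i j : Fin m, i ≠ j → ¬ Conflict (T i) (T j)) :
    ∀ (π : Equiv.Perm (Fin m)) (σ : α → V),
      (List.finRange m).foldl (fun s k => applyT (T (π k)) s) σ =
        (List.finRange m).foldl (fun s k => applyT (T k) s) σ := by
  intro π σ
  rw [← List.foldl_map (f := π) (g := fun s k => applyT (T k) s)]
  refine (Equiv.Perm.map_finRange_perm π).foldl_eq' (fun i _ j _ s => ?_) σ
  rcases eq_or_ne i j with rfl | hij
  · rfl
  · exact applyT_comm_of_not_conflict (h i j hij) s
end

section
/- Bin-order execution is correct: executing the transactions sorted lexicographically by (bin number, original index) — i.e., all of bin 0 in index order, then all of bin 1, and so on — yields, from every initial state, the same final state as executing T_0, …, T_{n−1} serially in index order. -/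
/-- `bin` satisfies the CalculateBin recursion: `bin i = 0` if no `j < i` conflicts
with `T i`, and otherwise `bin i = 1 + max {bin j : j < i and T j conflicts with T i}`. -/
def BinSpec {α V : Type*} {n : ℕ} (T : Fin n → OTxn α V) (bin : Fin n → ℕ) : Prop :=
  ∀ i : Fin n,
    ((¬ ∃ j : Fin n, j < i ∧ Conflict (T j) (T i)) → bin i = 0) ∧
    ((∃ j : Fin n, j < i ∧ Conflict (T j) (T i)) →
      bin i = 1 + sSup (bin '' {j : Fin n | j < i ∧ Conflict (T j) (T i)}))

theorem List.foldl_comm_of_forall_mem {β ι : Type*} {f : β → ι → β} {a : ι} {l : List ι}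
    (h : ∀ x ∈ l, ∀ s, f (f s x) a = f (f s a) x) (s : β) :
    f (l.foldl f s) a = l.foldl f (f s a) := by
  induction l generalizing s with
  | nil => rfl
  | cons x l ih =>
    rw [List.foldl_cons, List.foldl_cons, ih fun y hy => h y (List.mem_cons_of_mem _ hy),
      h x List.mem_cons_self]

/-- Folding over a rearrangement of a sorted list gives the same result, provided that the
steps at any two indices that are out of order commute. -/
theorem List.Perm.foldl_eq_of_pairwise_lt_or_comm {β ι : Type*} [Preorder ι] {f : β → ι → β}
    {l₁ l₂ : List ι} (hp : l₁.Perm l₂)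
    (h₁ : l₁.Pairwise fun i j => i < j ∨ ∀ s, f (f s i) j = f (f s j) i)
    (h₂ : l₂.Pairwise (· < ·)) (s : β) :
    l₁.foldl f s = l₂.foldl f s := by
  induction l₂ generalizing l₁ s with
  | nil => rw [hp.eq_nil]
  | cons a l₂ ih =>
    obtain ⟨u, v, rfl⟩ := List.append_of_mem (hp.mem_iff.2 List.mem_cons_self)
    have hp' : (u ++ v).Perm l₂ := (List.perm_middle.symm.trans hp).cons_inv
    rw [List.pairwise_cons] at h₂
    have hcomm : ∀ x ∈ u, ∀ s, f (f s x) a = f (f s a) x := fun x hx =>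
      ((List.pairwise_append.1 h₁).2.2 x hx a List.mem_cons_self).resolve_left
        (h₂.1 x (hp'.mem_iff.1 (List.mem_append_left v hx))).asymm
    rw [List.foldl_append, List.foldl_cons, List.foldl_comm_of_forall_mem hcomm,
      ← List.foldl_append, List.foldl_cons]
    exact ih hp' (h₁.sublist ((List.sublist_cons_self a v).append_left u)) h₂.2 _

theorem BinSpec.lt_of_conflict {α V : Type*} {n : ℕ} {T : Fin n → OTxn α V} {bin : Fin n → ℕ}
    (hbin : BinSpec T bin) {i j : Fin n} (hij : i < j) (h : Conflict (T i) (T j)) :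
    bin i < bin j := by
  rw [(hbin j).2 ⟨i, hij, h⟩, Nat.add_comm, Nat.lt_succ_iff]
  exact le_csSup (Set.toFinite _).bddAbove ⟨i, ⟨hij, h⟩, rfl⟩

/-- Bin-order execution is correct: executing the transactions sorted
lexicographically by (bin number, original index) yields, from every initial
state, the same final state as serial execution in index order. -/
theorem bin_order_execution_eq {α V : Type*} [DecidableEq α] {n : ℕ}
    (T : Fin n → OTxn α V) (bin : Fin n → ℕ) (hbin : BinSpec T bin)
    (π : Equiv.Perm (Fin n))
    (hπ : ∀ k l : Fin n, k < l →
      bin (π k) < bin (π l) ∨ (bin (π k) = bin (π l) ∧ π k < π l)) :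
    ∀ σ : α → V,
      (List.finRange n).foldl (fun s k => applyT (T (π k)) s) σ =
        (List.finRange n).foldl (fun s k => applyT (T k) s) σ := by
  intro σ
  rw [← List.foldl_map (f := π) (g := fun s k => applyT (T k) s)]
  refine List.Perm.foldl_eq_of_pairwise_lt_or_comm ?_ ?_ (List.pairwise_lt_finRange n) σ
  · exact (List.perm_ext_iff_of_nodup ((List.nodup_finRange n).map π.injective)
      (List.nodup_finRange n)).2 fun k => by
        simpa using ⟨π.symm k, π.apply_symm_apply k⟩
  · refine List.pairwise_map.2 ((List.pairwise_lt_finRange n).imp fun {k l} hkl => ?_)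
    by_contra! hcon
    obtain ⟨hle, s, hs⟩ := hcon
    have hlt : π l < π k := hle.lt_of_ne (π.injective.ne hkl.ne')
    have hconf : Conflict (T (π l)) (T (π k)) := by
      by_contra hnot
      exact hs (applyT_comm_of_not_conflict hnot s).symm
    have hb := hbin.lt_of_conflict hlt hconf
    rcases hπ k l hkl with h | h
    · exact h.asymm hb
    · exact hb.ne' h.1
end

section
/- Parallel execution within a bin equals sequential execution: let S be a finite set of pairwise non-conflicting transactions (so their write sets are pairwise disjoint). Define the simultaneous application of S to a state σ as the state whose value at address a is out_T(σ)(a) if a lies in W(T) for the (necessarily unique) T ∈ S with a ∈ W(T), and σ(a) otherwise. Then the simultaneous application of S to σ equals the result of applying the transactions of S to σ sequentially in any order. -/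
/-- Simultaneous (parallel) application of a finite set `S` of transactions:
the value at `a` is `out (T i) σ a` for the transaction `T i`, `i ∈ S`, writing `a`
(if any), and `σ a` otherwise. -/
noncomputable def simApply {ι α V : Type*} [DecidableEq α] (S : Finset ι)
    (T : ι → OTxn α V) (σ : α → V) : α → V :=
  fun a => if h : ∃ i ∈ S, a ∈ (T i).writes then (T h.choose).out σ a else σ a

theorem foldl_applyT_of_notMem {ι α V : Type*} [DecidableEq α] (T : ι → OTxn α V) (a : α) :
    ∀ (L : List ι) (σ : α → V), (∀ i ∈ L, a ∉ (T i).writes) →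
      L.foldl (fun s i => applyT (T i) s) σ a = σ a := by
  intro L
  induction L with
  | nil => intro σ _; rfl
  | cons i L ih =>
    intro σ h
    rw [List.foldl_cons, ih _ fun j hj => h j (List.mem_cons_of_mem _ hj)]
    exact if_neg (h i List.mem_cons_self)

theorem foldl_applyT_of_mem {ι α V : Type*} [DecidableEq α] (T : ι → OTxn α V)
    {i : ι} {a : α} (ha : a ∈ (T i).writes) {L : List ι} (hL : L.Nodup) (hi : i ∈ L)
    (hc : ∀ j ∈ L, i ≠ j → ¬ Conflict (T i) (T j)) (σ : α → V) :
    L.foldl (fun s i => applyT (T i) s) σ a = (T i).out σ a := by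
  obtain ⟨L₁, L₂, rfl⟩ := List.append_of_mem hi
  have hne : ∀ j, j ∈ L₁ ∨ j ∈ L₂ → i ≠ j := by
    rintro j hj rfl
    grind
  rw [List.foldl_append, List.foldl_cons, foldl_applyT_of_notMem]
  · refine (if_pos ha).trans ((T i).coh _ _ (fun b hb => ?_) a ha)
    exact foldl_applyT_of_notMem T b L₁ σ fun j hj hw =>
      hc j (by simp [hj]) (hne j (.inl hj)) (.inr (.inl ⟨b, hb, hw⟩))
  · exact fun j hj hw => hc j (by simp [hj]) (hne j (.inr hj)) (.inl ⟨a, ha, hw⟩)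

/-- Parallel execution within a bin equals sequential execution: simultaneous
application of a finite set of pairwise non-conflicting transactions equals
applying them sequentially in any order. -/
theorem simApply_eq_seq {ι α V : Type*} [DecidableEq α] (S : Finset ι)
    (T : ι → OTxn α V)
    (hS : ∀ i ∈ S, ∀ j ∈ S, i ≠ j → ¬ Conflict (T i) (T j)) :
    ∀ L : List ι, L.Nodup → (∀ i, i ∈ L ↔ i ∈ S) →
      ∀ σ : α → V, L.foldl (fun s i => applyT (T i) s) σ = simApply S T σ := by
  intro L hL hLS σ
  funext a
  unfold simApply
  split_ifs with h
  · obtain ⟨hi, ha⟩ := h.choose_spec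
    exact foldl_applyT_of_mem T ha hL ((hLS _).2 hi)
      (fun j hj => hS _ hi j ((hLS j).1 hj)) σ
  · exact foldl_applyT_of_notMem T a L σ fun i hi ha => h ⟨i, (hLS i).1 hi, ha⟩
end
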